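/- Let W = {x ∈ 𝔽₃⁴ : x₀ + x₁ + x₂ + x₃ = 0} be the sum-zero submodule of the permutation representation of the alternating group A₄ on 𝔽₃⁴ (A₄ permuting coordinates). Then W is a simple module over the group algebra 𝔽₃[A₄] (this is the standard 3-dimensional representation of A₄ over 𝔽₃), and W is a projective 𝔽₃[A₄]-module; consequently, every surjection of 𝔽₃[A₄]-modules onto W splits. -/

import Mathlib

/-- The sum-zero subspace `W = {x ∈ 𝔽₃⁴ : x₀ + x₁ + x₂ + x₃ = 0}` of `𝔽₃⁴`. -/
def sumZero : Submodule (ZMod 3) (Fin 4 → ZMod 3) where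
  carrier := {x | ∑ i, x i = 0}
  add_mem' := by
    intro a b ha hb
    simp only [Set.mem_setOf_eq, Pi.add_apply, Finset.sum_add_distrib] at *
    rw [ha, hb, add_zero]
  zero_mem' := by simp
  smul_mem' := by
    intro c x hx
    simp only [Set.mem_setOf_eq, Pi.smul_apply, smul_eq_mul, ← Finset.mul_sum] at *
    rw [hx, mul_zero]

/-- The standard 3-dimensional representation of `A₄` over `𝔽₃`: the action of `A₄` on the
sum-zero subspace of `𝔽₃⁴` by permuting coordinates. -/
noncomputable def stdRep :
    Representation (ZMod 3) (alternatingGroup (Fin 4)) sumZero where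
  toFun g :=
    { toFun := fun x =>
        ⟨fun i => x.1 (((g⁻¹ : alternatingGroup (Fin 4)) : Equiv.Perm (Fin 4)) i), by
          have hx : ∑ i, x.1 i = 0 := x.2
          show ∑ i, x.1 (((g⁻¹ : alternatingGroup (Fin 4)) : Equiv.Perm (Fin 4)) i) = 0
          rw [Equiv.sum_comp]
          exact hx⟩
      map_add' := fun a b => Subtype.ext <| by ext i; simp
      map_smul' := fun c a => Subtype.ext <| by ext i; simp }
  map_one' := by
    apply LinearMap.ext
    intro x
    apply Subtype.ext
    ext i
    simp
  map_mul' := fun g h => by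
    apply LinearMap.ext
    intro x
    apply Subtype.ext
    ext i
    simp [mul_inv_rev, Equiv.Perm.mul_apply]

noncomputable instance : AddCommGroup stdRep.asModule :=
  inferInstanceAs (AddCommGroup sumZero)

/-- The vector `(1, 1, -1, -1)`, an eigenvector of the Klein four-subgroup in `sumZero`. -/
def kleinVec : sumZero := ⟨![1, 1, -1, -1], show ∑ i, ![1, 1, -1, -1] i = (0 : ZMod 3) by decide⟩

/-- The pairing of a vector of `sumZero` with `kleinVec` under the standard dot product. -/
def kleinPairing : sumZero →ₗ[ZMod 3] ZMod 3 :=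
  dotProductBilin (ZMod 3) (ZMod 3) kleinVec.1 ∘ₗ sumZero.subtype

theorem sum_kleinPairing_smul_kleinVec (x : sumZero) :
    ∑ g, kleinPairing (stdRep g x) • stdRep g⁻¹ kleinVec = x := by
  have key : ∀ x : Fin 4 → ZMod 3, ∑ i, x i = 0 → ∀ i,
      ∑ g : alternatingGroup (Fin 4),
        (∑ j, ![1, 1, -1, -1] j * x ((g⁻¹ : alternatingGroup (Fin 4)).1 j)) *
          ![1, 1, -1, -1] ((g⁻¹⁻¹ : alternatingGroup (Fin 4)).1 i) = x i := by
    decide +kernel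
  ext i
  rw [AddSubmonoidClass.coe_finsetSum, Finset.sum_apply]
  exact key x.1 x.2 i

theorem sum_kleinPairing_kleinVec_smul (x : sumZero) :
    ∑ g, kleinPairing (stdRep g kleinVec) • stdRep g⁻¹ x = kleinPairing x • kleinVec := by
  have key : ∀ x : Fin 4 → ZMod 3, ∑ i, x i = 0 → ∀ i,
      ∑ g : alternatingGroup (Fin 4),
        (∑ j, ![1, 1, -1, -1] j * ![1, 1, -1, -1] ((g⁻¹ : alternatingGroup (Fin 4)).1 j)) *
          x ((g⁻¹⁻¹ : alternatingGroup (Fin 4)).1 i) =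
      (∑ j, ![1, 1, -1, -1] j * x j) * ![1, 1, -1, -1] i := by
    decide +kernel
  ext i
  rw [AddSubmonoidClass.coe_finsetSum, Finset.sum_apply]
  exact key x.1 x.2 i

/-- The `𝔽₃[A₄]`-linear map `x ↦ ∑ g, ⟨g x, kleinVec⟩ g⁻¹`, a section of `a ↦ a • kleinVec`. -/
noncomputable def kleinSection :
    stdRep.asModule →ₗ[MonoidAlgebra (ZMod 3) (alternatingGroup (Fin 4))]
      MonoidAlgebra (ZMod 3) (alternatingGroup (Fin 4)) :=
  ((kleinPairing ∘ₗ stdRep.asModuleEquiv.toLinearMap).smulRight 1).sumOfConjugatesEquivariant _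

theorem kleinSection_smul (y x : stdRep.asModule) :
    kleinSection y • x = stdRep.asModuleEquiv.symm
      (∑ g, kleinPairing (stdRep g (stdRep.asModuleEquiv y)) •
        stdRep g⁻¹ (stdRep.asModuleEquiv x)) := by
  apply stdRep.asModuleEquiv.injective
  simp [kleinSection, LinearMap.sumOfConjugatesEquivariant_apply, LinearMap.conjugate_apply,
    Representation.asModuleEquiv_map_smul, Representation.asAlgebraHom_single]
  rfl

theorem kleinSection_smul_kleinVec (x : stdRep.asModule) :
    kleinSection x • stdRep.asModuleEquiv.symm kleinVec = x := by
  simp [kleinSection_smul, sum_kleinPairing_smul_kleinVec]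

theorem kleinSection_kleinVec_smul (x : stdRep.asModule) :
    kleinSection (stdRep.asModuleEquiv.symm kleinVec) • x =
      kleinPairing (stdRep.asModuleEquiv x) • stdRep.asModuleEquiv.symm kleinVec := by
  simp [kleinSection_smul, sum_kleinPairing_kleinVec_smul]

theorem exists_kleinPairing_ne_zero {x : sumZero} (hx : x ≠ 0) :
    ∃ g, kleinPairing (stdRep g x) ≠ 0 := by
  by_contra! h
  apply hx
  rw [← sum_kleinPairing_smul_kleinVec x]
  simp [h]

theorem isSimpleModule_stdRep :
    IsSimpleModule (MonoidAlgebra (ZMod 3) (alternatingGroup (Fin 4))) stdRep.asModule := by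
  rw [isSimpleModule_iff_toSpanSingleton_surjective]
  refine ⟨⟨stdRep.asModuleEquiv.symm kleinVec, 0, ?_⟩, fun x hx y => ?_⟩
  · rw [ne_eq, LinearEquiv.map_eq_zero_iff]
    decide
  obtain ⟨g, hg⟩ := exists_kleinPairing_ne_zero (x := stdRep.asModuleEquiv x)
    (stdRep.asModuleEquiv.map_ne_zero_iff.mpr hx)
  set c := kleinPairing (stdRep g (stdRep.asModuleEquiv x)) with hc
  refine ⟨kleinSection y *
    (c⁻¹ • (kleinSection (stdRep.asModuleEquiv.symm kleinVec) *
      MonoidAlgebra.single g 1)), ?_⟩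
  have : c⁻¹ • c • stdRep.asModuleEquiv.symm kleinVec = stdRep.asModuleEquiv.symm kleinVec := by
    rw [smul_smul, inv_mul_cancel₀ hg, one_smul]
  rw [LinearMap.toSpanSingleton_apply, mul_smul, smul_assoc, mul_smul,
    kleinSection_kleinVec_smul, Representation.asModuleEquiv_map_smul,
    Representation.asAlgebraHom_single, one_smul, ← hc, this, kleinSection_smul_kleinVec]

theorem projective_stdRep :
    Module.Projective (MonoidAlgebra (ZMod 3) (alternatingGroup (Fin 4))) stdRep.asModule :=
  .of_split kleinSection (LinearMap.toSpanSingleton _ _ (stdRep.asModuleEquiv.symm kleinVec))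
    (LinearMap.ext kleinSection_smul_kleinVec)

/-- The sum-zero subspace `W` of the permutation representation of `A₄`
on `𝔽₃⁴` is a simple `𝔽₃[A₄]`-module (the standard 3-dimensional representation), it is
projective as an `𝔽₃[A₄]`-module, and consequently every surjection of `𝔽₃[A₄]`-modules
onto `W` splits. -/
theorem stdRep_simple_projective_split :
    IsSimpleModule (MonoidAlgebra (ZMod 3) (alternatingGroup (Fin 4))) stdRep.asModule ∧
    Module.Projective (MonoidAlgebra (ZMod 3) (alternatingGroup (Fin 4))) stdRep.asModule ∧
    (∀ (N : Type) [AddCommGroup N]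
        [Module (MonoidAlgebra (ZMod 3) (alternatingGroup (Fin 4))) N]
        (f : N →ₗ[MonoidAlgebra (ZMod 3) (alternatingGroup (Fin 4))] stdRep.asModule),
      Function.Surjective f →
      ∃ s : stdRep.asModule →ₗ[MonoidAlgebra (ZMod 3) (alternatingGroup (Fin 4))] N,
        f.comp s = LinearMap.id) := by
  have := projective_stdRep
  exact ⟨isSimpleModule_stdRep, projective_stdRep, fun N _ _ f hf =>
    f.exists_rightInverse_of_surjective (LinearMap.range_eq_top.mpr hf)⟩
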